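/- arXiv:2011.14571 — 7 statements merged into one kernel-verified Lean document; each statement's English description precedes it below -/
import Mathlib

section
/- Suppose M, σ, r are positive real constants with rσ² < M². Then c := (2σ√r·e^{−b²})/(M√π) + φ(b) satisfies c ≥ 1. -/
/-- The Gauss error function `erf x = (2/√π) ∫₀ˣ e^{−t²} dt`. -/
noncomputable def erf (x : ℝ) : ℝ :=
  (2 / Real.sqrt Real.pi) * ∫ t in (0:ℝ)..x, Real.exp (-t ^ 2)

/-- The derivative of `2 / (3x + √(x² + 4)) * e^{-x²} + ∫₀ˣ e^{-t²} dt`. -/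
lemma hasDerivAt_sampford (x : ℝ) (hx : 0 ≤ x) :
    HasDerivAt (fun y : ℝ ↦ 2 / (3 * y + √(y ^ 2 + 4)) * Real.exp (-y ^ 2)
        + ∫ t in (0 : ℝ)..y, Real.exp (-t ^ 2))
      (2 * Real.exp (-x ^ 2) / (√(x ^ 2 + 4) * (3 * x + √(x ^ 2 + 4)) ^ 2)
        * (x ^ 3 + 3 * x - √(x ^ 2 + 4) * (x ^ 2 + 1))) x := by
  have hR : 0 < √(x ^ 2 + 4) := by positivity
  have hR2 : √(x ^ 2 + 4) ^ 2 = x ^ 2 + 4 := Real.sq_sqrt (by positivity)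
  have hint : HasDerivAt (fun y : ℝ ↦ ∫ t in (0 : ℝ)..y, Real.exp (-t ^ 2))
      (Real.exp (-x ^ 2)) x := by
    have hcont : Continuous fun t : ℝ ↦ Real.exp (-t ^ 2) := by fun_prop
    exact hcont.deriv_integral _ 0 x ▸
      (intervalIntegral.differentiable_integral_of_continuous hcont x).hasDerivAt
  have hsq : HasDerivAt (fun y : ℝ ↦ y ^ 2) (2 * x) x := by simpa using hasDerivAt_pow 2 x
  have hsqrt := (hsq.add_const 4).sqrt (by positivity)
  have hden := ((hasDerivAt_id' x).const_mul 3).add hsqrt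
  have hfrac := (hasDerivAt_const x (2 : ℝ)).div hden (by simp only [Pi.add_apply]; positivity)
  have hall := (hfrac.mul hsq.neg.exp).add hint
  refine hall.congr_deriv ?_
  simp only [Pi.add_apply, Pi.neg_apply, Pi.div_apply]
  generalize √(x ^ 2 + 4) = R at *
  have hne : 3 * x + R ≠ 0 := by positivity
  field_simp
  linear_combination (R + 2 * x) * hR2

/-- Sampford's upper bound for the Mills ratio, in terms of `e^{-t²}`. -/
lemma sampford_bound (b : ℝ) (hb : 0 ≤ b) :
    √Real.pi / 2 ≤ 2 / (3 * b + √(b ^ 2 + 4)) * Real.exp (-b ^ 2)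
      + ∫ t in (0 : ℝ)..b, Real.exp (-t ^ 2) := by
  have hanti : AntitoneOn (fun y : ℝ ↦ 2 / (3 * y + √(y ^ 2 + 4)) * Real.exp (-y ^ 2)
      + ∫ t in (0 : ℝ)..y, Real.exp (-t ^ 2)) (Set.Ici 0) := by
    refine antitoneOn_of_hasDerivWithinAt_nonpos (convex_Ici 0)
      (fun x hx ↦ (hasDerivAt_sampford x hx).continuousAt.continuousWithinAt)
      (fun x hx ↦ (hasDerivAt_sampford x (interior_subset hx)).hasDerivWithinAt) ?_
    intro x hx
    have hx : 0 ≤ x := interior_subset hx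
    refine mul_nonpos_of_nonneg_of_nonpos (by positivity) (sub_nonpos.2 ?_)
    refine abs_le_of_sq_le_sq' ?_ (by positivity) |>.2
    rw [mul_pow, Real.sq_sqrt (by positivity)]
    nlinarith
  have hgauss : MeasureTheory.IntegrableOn (fun t : ℝ ↦ Real.exp (-t ^ 2)) (Set.Ioi 0) := by
    simpa using (integrable_exp_neg_mul_sq (b := 1) one_pos).integrableOn
  have hlim := MeasureTheory.intervalIntegral_tendsto_integral_Ioi 0 hgauss Filter.tendsto_id
  have hval : ∫ t in Set.Ioi (0 : ℝ), Real.exp (-t ^ 2) = √Real.pi / 2 := by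
    simpa using integral_gaussian_Ioi 1
  rw [hval] at hlim
  refine le_of_tendsto hlim ?_
  filter_upwards [Filter.eventually_ge_atTop b] with x hx
  have hx0 : 0 ≤ x := hb.trans hx
  exact (le_add_of_nonneg_left (by positivity)).trans (hanti hb hx0 hx)

/-- For positive constants `M, σ, r` with `rσ² < M²`, the constant
`c = (2σ√r e^{−b²})/(M√π) + φ(b)` satisfies `c ≥ 1`. -/
theorem stmt_1 (M σ r : ℝ) (hM : 0 < M) (hσ : 0 < σ) (hr : 0 < r)
    (hreg : r * σ ^ 2 < M ^ 2) (a b c : ℝ)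
    (ha : a = (1 / 2) * (Real.sqrt (1 + 8 * r * σ ^ 2 / M ^ 2) - 1))
    (hb : b = (1 - a) * M / (2 * σ * Real.sqrt r))
    (hc : c = (2 * σ * Real.sqrt r * Real.exp (-b ^ 2)) / (M * Real.sqrt Real.pi) + erf b) :
    1 ≤ c := by
  obtain ⟨s, hs⟩ : ∃ s, s = σ * √r / M := ⟨_, rfl⟩
  have hs0 : 0 < s := by rw [hs]; positivity
  have hs2 : s ^ 2 = r * σ ^ 2 / M ^ 2 := by
    rw [hs, div_pow, mul_pow, Real.sq_sqrt hr.le, mul_comm]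
  have hs1 : s ^ 2 < 1 := by rwa [hs2, div_lt_one (by positivity)]
  have haS : 1 + 8 * r * σ ^ 2 / M ^ 2 = 1 + 8 * s ^ 2 := by rw [hs2]; ring
  rw [haS] at ha
  have hsqrt : √(1 + 8 * s ^ 2) ^ 2 = 1 + 8 * s ^ 2 := Real.sq_sqrt (by positivity)
  have ha0 : 0 ≤ a := by
    have : 1 ≤ √(1 + 8 * s ^ 2) := Real.one_le_sqrt.2 (by nlinarith)
    linarith
  have haq : a ^ 2 + a = 2 * s ^ 2 := by rw [ha]; linear_combination hsqrt / 4
  have ha1 : a < 1 := by nlinarith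
  have hsb : 2 * s * b = 1 - a := by
    rw [hb, hs]
    field_simp
  have hb0 : 0 ≤ b := by
    rw [hb]
    have : 0 < 1 - a := by linarith
    positivity
  have hroot : s * √(b ^ 2 + 4) = 2 - 3 * s * b := by
    rw [← Real.sqrt_sq hs0.le, ← Real.sqrt_mul (by positivity), Real.sqrt_sq hs0.le,
      Real.sqrt_eq_iff_mul_self_eq (by positivity) (by linarith)]
    obtain rfl : a = 1 - 2 * s * b := by linarith
    linear_combination -2 * haq
  have hfrac : 2 / (3 * b + √(b ^ 2 + 4)) = s := by
    rw [div_eq_iff (by positivity)]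
    linarith
  have hbound := sampford_bound b hb0
  rw [hfrac] at hbound
  have hpi : 0 < √Real.pi := Real.sqrt_pos.2 Real.pi_pos
  have hc' : c = 2 / √Real.pi *
      (s * Real.exp (-b ^ 2) + ∫ t in (0 : ℝ)..b, Real.exp (-t ^ 2)) := by
    rw [hc, hs, erf]
    field_simp
  rw [hc']
  calc (1 : ℝ) = 2 / √Real.pi * (√Real.pi / 2) := by field_simp
    _ ≤ _ := by gcongr
end

section
/- Suppose M, σ, r are positive real constants with rσ² < M², and let p ∈ (0,1). For every x ∈ (q*, p] and every real y ≥ 0 satisfying φ(y) = c(p − x)/(p(1 − x)), one has c·√π·((1−p)x/(p(1−x)))·e^{y²} − 2σ√r/M > 0. -/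
open Real in
/-- The derivative of the error function. -/
lemma hasDerivAt_erf (x : ℝ) : HasDerivAt erf (2 / √π * exp (-x ^ 2)) x := by
  have hcont : Continuous fun t : ℝ => exp (-t ^ 2) := by fun_prop
  exact (intervalIntegral.integral_hasDerivAt_right (hcont.intervalIntegrable 0 x)
    (hcont.stronglyMeasurableAtFilter _ _) hcont.continuousAt).const_mul (2 / √π)

lemma strictMono_erf : StrictMono erf := by
  refine strictMono_of_deriv_pos fun x => ?_
  rw [(hasDerivAt_erf x).deriv]
  positivity

lemma erf_zero : erf 0 = 0 := by simp [erf]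

open Real in
/-- The function `√π φ(t) + K e^{-t²}` is strictly increasing where `K t < 1`. -/
lemma sqrt_pi_mul_erf_add_lt {K y b : ℝ} (hK : 0 < K) (hb : K * b < 1) (hy : y < b) :
    √π * erf y + K * exp (-y ^ 2) < √π * erf b + K * exp (-b ^ 2) := by
  have hderiv (t : ℝ) : HasDerivAt (fun t => √π * erf t + K * exp (-t ^ 2))
      (2 * exp (-t ^ 2) * (1 - K * t)) t := by
    have hpi : √π ≠ 0 := by positivity
    refine (((hasDerivAt_erf t).const_mul (√π)).add
      (((hasDerivAt_pow 2 t).neg.exp).const_mul K)).congr_deriv ?_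
    simp only [Pi.neg_apply]
    field_simp
    push_cast
    ring
  refine strictMonoOn_of_deriv_pos (convex_Iic b)
    (fun t _ => (hderiv t).continuousAt.continuousWithinAt) (fun t ht => ?_)
    (Set.mem_Iic.2 hy.le) (Set.mem_Iic.2 le_rfl) hy
  rw [interior_Iic, Set.mem_Iio] at ht
  rw [(hderiv t).deriv]
  have : K * t < 1 := (mul_lt_mul_of_pos_left ht hK).trans hb
  have : 0 < 1 - K * t := by linarith
  positivity

/-- For positive constants `M, σ, r` with `rσ² < M²` and `p ∈ (0,1)`:
for every `x ∈ (q*, p]` and every `y ≥ 0` with `φ(y) = c(p − x)/(p(1 − x))`, one has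
`c √π ((1−p)x/(p(1−x))) e^{y²} − 2σ√r/M > 0`. -/
theorem stmt_3 (M σ r : ℝ) (hM : 0 < M) (hσ : 0 < σ) (hr : 0 < r)
    (hreg : r * σ ^ 2 < M ^ 2) (a b c p qstar : ℝ)
    (ha : a = (1 / 2) * (Real.sqrt (1 + 8 * r * σ ^ 2 / M ^ 2) - 1))
    (hb : b = (1 - a) * M / (2 * σ * Real.sqrt r))
    (hc : c = (2 * σ * Real.sqrt r * Real.exp (-b ^ 2)) / (M * Real.sqrt Real.pi) + erf b)
    (hp : p ∈ Set.Ioo (0:ℝ) 1)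
    (hqs : qstar = p * (c - erf b) / (c - p * erf b)) :
    ∀ x ∈ Set.Ioc qstar p, ∀ y : ℝ, 0 ≤ y →
      erf y = c * (p - x) / (p * (1 - x)) →
      0 < c * Real.sqrt Real.pi * ((1 - p) * x / (p * (1 - x))) * Real.exp (y ^ 2)
            - 2 * σ * Real.sqrt r / M := by
  rintro x ⟨hqx, hxp⟩ y - hy
  obtain ⟨hp0, hp1⟩ := hp
  have hpi : 0 < Real.sqrt Real.pi := by positivity
  have hsr : 0 < Real.sqrt r := by positivity
  have ha0 : 0 < a := by
    have : 1 < Real.sqrt (1 + 8 * r * σ ^ 2 / M ^ 2) := by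
      rw [Real.lt_sqrt zero_le_one]
      have : 0 < 8 * r * σ ^ 2 / M ^ 2 := by positivity
      linarith
    linarith
  have ha1 : a < 1 := by
    have : Real.sqrt (1 + 8 * r * σ ^ 2 / M ^ 2) < 3 := by
      rw [Real.sqrt_lt' three_pos]
      have : 8 * r * σ ^ 2 / M ^ 2 < 8 := by
        rw [div_lt_iff₀ (by positivity)]
        linarith
      linarith
    linarith
  set K := 2 * σ * Real.sqrt r / M with hKdef
  have hK : 0 < K := by positivity
  have hKb : K * b = 1 - a := by
    rw [hb, hKdef]
    field_simp
  have hb0 : 0 < b := pos_of_mul_pos_right (by rw [hKb]; linarith) hK.le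
  have herf : 0 < erf b := erf_zero ▸ strictMono_erf hb0
  have hcK : Real.sqrt Real.pi * c = Real.sqrt Real.pi * erf b + K * Real.exp (-b ^ 2) := by
    rw [hc, hKdef]
    field_simp
    ring
  have hcb : erf b < c := by
    have : 0 < K * Real.exp (-b ^ 2) := by positivity
    exact lt_of_mul_lt_mul_left (by linarith) hpi.le
  have hx1 : 0 < 1 - x := by linarith
  have hyb : y < b := by
    rw [← strictMono_erf.lt_iff_lt, hy, div_lt_iff₀ (by positivity)]
    rw [hqs, div_lt_iff₀ (by nlinarith)] at hqx
    linarith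
  have hcy : c * ((1 - p) * x / (p * (1 - x))) = c - erf y := by
    rw [hy]
    field_simp
    ring
  have hlt := sqrt_pi_mul_erf_add_lt hK (by linarith) hyb
  have hexp : Real.exp (-y ^ 2) * Real.exp (y ^ 2) = 1 := by
    rw [← Real.exp_add, neg_add_cancel, Real.exp_zero]
  have hmul : 0 < (Real.sqrt Real.pi * (c - erf y) - K * Real.exp (-y ^ 2)) * Real.exp (y ^ 2) :=
    mul_pos (by linarith) (Real.exp_pos _)
  rw [mul_right_comm c, hcy]
  linear_combination hmul - K * hexp
end

section
/- Suppose M, σ, r, l are positive real constants with rσ² ≥ M². Define V(q) = (M/r)·(1 − ((1−p)/p)^a·(q/(1−q))^a) for q ∈ (0,p). Then V satisfies the differential equation V''(q)/2 + V'(q)/q − rσ²·V(q)/(M²q²(1−q)²) + σ²/(M·q²(1−q)²) = 0 for all q ∈ (0,p); moreover V(q) → M/r as q → 0⁺ and V(q) → 0 as q → p⁻. -/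
/-- The derivative of a power of the odds ratio `q / (1 - q)`. -/
theorem hasDerivAt_odds_rpow (a : ℝ) {q : ℝ} (h0 : 0 < q) (h1 : q < 1) :
    HasDerivAt (fun x : ℝ => (x / (1 - x)) ^ a)
      (a * (q / (1 - q)) ^ a / (q * (1 - q))) q := by
  have h1' : 0 < 1 - q := sub_pos.2 h1
  have hodds : 0 < q / (1 - q) := div_pos h0 h1'
  have h := ((hasDerivAt_id q).div ((hasDerivAt_id q).const_sub 1) h1'.ne').rpow_const
    (p := a) (Or.inl hodds.ne')
  refine h.congr_deriv ?_
  simp only [Pi.div_apply, id]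
  rw [Real.rpow_sub_one hodds.ne']
  field_simp
  ring

/-- The second derivative of a power of the odds ratio `q / (1 - q)`. -/
theorem hasDerivAt_deriv_odds_rpow (a : ℝ) {q : ℝ} (h0 : 0 < q) (h1 : q < 1) :
    HasDerivAt (fun x : ℝ => a * (x / (1 - x)) ^ a / (x * (1 - x)))
      (a * (a - 1 + 2 * q) * (q / (1 - q)) ^ a / (q ^ 2 * (1 - q) ^ 2)) q := by
  have h1' : 0 < 1 - q := sub_pos.2 h1
  have h := ((hasDerivAt_odds_rpow a h0 h1).const_mul a).div
    ((hasDerivAt_id q).mul ((hasDerivAt_id q).const_sub 1)) (mul_pos h0 h1').ne'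
  refine h.congr_deriv ?_
  simp only [Pi.mul_apply, id]
  field_simp
  ring

/-- In the regime `rσ² ≥ M²`, with `p = (1+a)rl/((1+a)rl + aM)`, the function
`V(q) = (M/r)(1 − ((1−p)/p)^a (q/(1−q))^a)` satisfies
`V''/2 + V'/q − rσ²V/(M²q²(1−q)²) + σ²/(Mq²(1−q)²) = 0` on `(0,p)`,
with `V(q) → M/r` as `q → 0⁺` and `V(q) → 0` as `q → p⁻`. -/
theorem stmt_4 (M σ r l : ℝ) (hM : 0 < M) (hσ : 0 < σ) (hr : 0 < r) (hl : 0 < l)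
    (hreg : M ^ 2 ≤ r * σ ^ 2) (a p : ℝ)
    (ha : a = (1 / 2) * (Real.sqrt (1 + 8 * r * σ ^ 2 / M ^ 2) - 1))
    (hp : p = (1 + a) * r * l / ((1 + a) * r * l + a * M))
    (V : ℝ → ℝ)
    (hV : ∀ q, V q = (M / r) * (1 - ((1 - p) / p) ^ a * (q / (1 - q)) ^ a)) :
    (∀ q ∈ Set.Ioo (0:ℝ) p,
      deriv (deriv V) q / 2 + deriv V q / q
        - r * σ ^ 2 * V q / (M ^ 2 * q ^ 2 * (1 - q) ^ 2)
        + σ ^ 2 / (M * q ^ 2 * (1 - q) ^ 2) = 0) ∧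
    Filter.Tendsto V (nhdsWithin 0 (Set.Ioi 0)) (nhds (M / r)) ∧
    Filter.Tendsto V (nhdsWithin p (Set.Iio p)) (nhds 0) := by
  have hs0 : 0 < 8 * r * σ ^ 2 / M ^ 2 := by positivity
  have hs := Real.sq_sqrt (by positivity : 0 ≤ 1 + 8 * r * σ ^ 2 / M ^ 2)
  have hs1 : 1 < √(1 + 8 * r * σ ^ 2 / M ^ 2) := by
    rw [Real.lt_sqrt zero_le_one]
    linarith
  have ha0 : 0 < a := by
    rw [ha]
    linarith
  have hquad : a * (a + 1) * M ^ 2 = 2 * r * σ ^ 2 := by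
    have h : a * (a + 1) = 2 * r * σ ^ 2 / M ^ 2 := by
      rw [ha]
      linear_combination hs / 4
    rw [h]
    field_simp
  have hp0 : 0 < p := by
    rw [hp]
    positivity
  have hp1 : p < 1 := by
    rw [hp, div_lt_one (by positivity)]
    linarith [mul_pos ha0 hM]
  have hp1' : 0 < 1 - p := sub_pos.2 hp1
  set c := ((1 - p) / p) ^ a with hc
  have hVeq : V = fun q => (M / r) * (1 - c * (q / (1 - q)) ^ a) := funext hV
  have hcont : ∀ q : ℝ, q < 1 → ContinuousAt V q := by
    intro q hq
    have hq' : 1 - q ≠ 0 := (sub_pos.2 hq).ne'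
    have h : ContinuousAt (fun x : ℝ => (x / (1 - x)) ^ a) q :=
      (continuousAt_id.div (continuousAt_const.sub continuousAt_id) hq').rpow_const
        (Or.inr ha0.le)
    rw [hVeq]
    exact continuousAt_const.mul (continuousAt_const.sub (continuousAt_const.mul h))
  refine ⟨?_, ?_, ?_⟩
  · rintro q ⟨hq0, hqp⟩
    have hq1 : q < 1 := hqp.trans hp1
    have hq1' : 0 < 1 - q := sub_pos.2 hq1
    have hderiv : ∀ x ∈ Set.Ioo (0 : ℝ) 1,
        deriv V x = (M / r) * -(c * (a * (x / (1 - x)) ^ a / (x * (1 - x)))) := by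
      rintro x ⟨hx0, hx1⟩
      rw [hVeq]
      exact (((hasDerivAt_odds_rpow a hx0 hx1).const_mul c).const_sub 1).const_mul (M / r)
        |>.deriv
    have hderiv2 : deriv (deriv V) q = (M / r) *
        -(c * (a * (a - 1 + 2 * q) * (q / (1 - q)) ^ a / (q ^ 2 * (1 - q) ^ 2))) := by
      rw [(Set.EqOn.eventuallyEq_of_mem hderiv (Ioo_mem_nhds hq0 hq1)).deriv_eq]
      exact (((hasDerivAt_deriv_odds_rpow a hq0 hq1).const_mul c).neg).const_mul (M / r)
        |>.deriv
    rw [hderiv2, hderiv q ⟨hq0, hq1⟩, hV q]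
    generalize (q / (1 - q)) ^ a = F
    field_simp
    linear_combination (-(c * F)) * hquad
  · have h := (hcont 0 one_pos).tendsto
    have h0 : V 0 = M / r := by simp [hV, Real.zero_rpow ha0.ne']
    rw [h0] at h
    exact h.mono_left nhdsWithin_le_nhds
  · have h := (hcont p hp1).tendsto
    have h0 : V p = 0 := by
      have hodds : (1 - p) / p * (p / (1 - p)) = 1 := by field_simp
      rw [hV, hc, ← Real.mul_rpow (by positivity) (by positivity), hodds]
      simp
    rw [h0] at h
    exact h.mono_left nhdsWithin_le_nhds
end

section
/- Suppose M, σ, r, l are positive real constants with rσ² ≥ M². Define U(q) = q·(M/r − (M/r − (1−p)l/p)·((1−p)/p)^a·(q/(1−q))^a). Then U(q) < l(1−q) for all q ∈ (0,p), and M·q − r·l·(1−q) ≥ 0 for all q ∈ [p,1]. -/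
/-- In the regime `rσ² ≥ M²`, with `p = (1+a)rl/((1+a)rl + aM)`, the function
`U(q) = q(M/r − (M/r − (1−p)l/p)((1−p)/p)^a (q/(1−q))^a)` satisfies `U(q) < l(1−q)` for all
`q ∈ (0,p)`, and `Mq − rl(1−q) ≥ 0` for all `q ∈ [p,1]`. -/
theorem stmt_7 (M σ r l : ℝ) (hM : 0 < M) (hσ : 0 < σ) (hr : 0 < r) (hl : 0 < l)
    (hreg : M ^ 2 ≤ r * σ ^ 2) (a p : ℝ)
    (ha : a = (1 / 2) * (Real.sqrt (1 + 8 * r * σ ^ 2 / M ^ 2) - 1))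
    (hp : p = (1 + a) * r * l / ((1 + a) * r * l + a * M))
    (U : ℝ → ℝ)
    (hU : ∀ q, U q = q * (M / r
      - (M / r - (1 - p) * l / p) * ((1 - p) / p) ^ a * (q / (1 - q)) ^ a)) :
    (∀ q ∈ Set.Ioo (0:ℝ) p, U q < l * (1 - q)) ∧
    (∀ q ∈ Set.Icc p 1, 0 ≤ M * q - r * l * (1 - q)) := by
  have ha0 : 0 < a := by
    have h : 0 < 8 * r * σ ^ 2 / M ^ 2 := by positivity
    have : 1 < Real.sqrt (1 + 8 * r * σ ^ 2 / M ^ 2) := by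
      rw [Real.lt_sqrt zero_le_one]
      linarith
    linarith
  have hD : 0 < (1 + a) * r * l + a * M := by positivity
  have hp0 : 0 < p := by rw [hp]; positivity
  have hpD : p * ((1 + a) * r * l + a * M) = (1 + a) * r * l := by
    rw [hp]; field_simp
  have hp1 : p < 1 := by
    rw [hp, div_lt_one hD]
    linarith [mul_pos ha0 hM]
  have hodds : (1 - p) / p = a * M / ((1 + a) * r * l) := by
    rw [div_eq_div_iff hp0.ne' (by positivity)]
    linear_combination -hpD
  constructor
  · rintro q ⟨hq0, hqp⟩
    have hq1 : 0 < 1 - q := by linarith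
    have hcoef : M / r - (1 - p) * l / p = M / r / (1 + a) := by
      rw [mul_div_right_comm, hodds]
      field_simp
      ring
    obtain ⟨x, hx⟩ : ∃ x, x = (1 - p) / p * (q / (1 - q)) := ⟨_, rfl⟩
    have hp1' : 0 < 1 - p := by linarith
    have hx0 : 0 < x := by rw [hx]; positivity
    have hx1 : x < 1 := by
      rw [hx, div_mul_div_comm, div_lt_one (by positivity)]
      nlinarith
    have hxq : l * (1 - q) * x = q * (M / r) * (a / (1 + a)) := by
      rw [hx, hodds]
      field_simp
    have hpow : ((1 - p) / p) ^ a * (q / (1 - q)) ^ a = x ^ a := by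
      rw [hx, Real.mul_rpow (by positivity) (by positivity)]
    have hbern := one_add_mul_self_lt_rpow_one_add (s := x - 1) (p := 1 + a)
      (by linarith) (by linarith) (by linarith)
    rw [add_sub_cancel, Real.rpow_add hx0, Real.rpow_one] at hbern
    have hc : 0 < q * (M / r) / (1 + a) := by positivity
    rw [hU, hcoef, mul_assoc (M / r / (1 + a)), hpow]
    refine lt_of_mul_lt_mul_right ?_ hx0.le
    rw [hxq]
    have hlin : (1 + a) * x - x * x ^ a < a := by linarith
    calc q * (M / r - M / r / (1 + a) * x ^ a) * x
        = q * (M / r) / (1 + a) * ((1 + a) * x - x * x ^ a) := by field_simp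
      _ < q * (M / r) / (1 + a) * a := mul_lt_mul_of_pos_left hlin hc
      _ = q * (M / r) * (a / (1 + a)) := by ring
  · rintro q ⟨hpq, -⟩
    have hthr : r * l * (1 - p) ≤ M * p := by
      have h : (1 + a) * (r * l * (1 - p)) = a * (M * p) := by linear_combination -hpD
      nlinarith [mul_pos hM hp0]
    nlinarith [mul_pos hr hl]
end

section
/- Suppose M, σ, r, l are positive real constants with rσ² < M². Then (2p(1−q*)σ√r/(c·√π·(1−p)·q*))·e^{−b²} = M; that is, the equilibrium attack intensity on the region (q*, p) extends continuously to the value M at q = q*. -/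
theorem erf_nonneg {x : ℝ} (hx : 0 ≤ x) : 0 ≤ erf x :=
  mul_nonneg (by positivity)
    (intervalIntegral.integral_nonneg hx fun _ _ => (Real.exp_pos _).le)

/-- In the regime `rσ² < M²`, with `p` and `q*` as in the equilibrium,
`(2p(1−q*)σ√r/(c√π(1−p)q*)) e^{−b²} = M`: the equilibrium attack intensity on `(q*,p)`
extends continuously to the value `M` at `q = q*` (using `y(q*) = b`). -/
theorem stmt_10 (M σ r l : ℝ) (hM : 0 < M) (hσ : 0 < σ) (hr : 0 < r) (hl : 0 < l)
    (hreg : r * σ ^ 2 < M ^ 2) (a b c p qstar : ℝ)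
    (ha : a = (1 / 2) * (Real.sqrt (1 + 8 * r * σ ^ 2 / M ^ 2) - 1))
    (hb : b = (1 - a) * M / (2 * σ * Real.sqrt r))
    (hc : c = (2 * σ * Real.sqrt r * Real.exp (-b ^ 2)) / (M * Real.sqrt Real.pi) + erf b)
    (hp : p = c * l * Real.sqrt (Real.pi * r) / (c * l * Real.sqrt (Real.pi * r) + σ))
    (hqs : qstar = p * (c - erf b) / (c - p * erf b)) :
    (2 * p * (1 - qstar) * σ * Real.sqrt r / (c * Real.sqrt Real.pi * (1 - p) * qstar))
      * Real.exp (-b ^ 2) = M := by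
  have ha1 : a < 1 := by
    have hratio : 8 * r * σ ^ 2 / M ^ 2 < 8 := by
      rw [div_lt_iff₀ (by positivity)]
      linarith
    have hsqrt : Real.sqrt (1 + 8 * r * σ ^ 2 / M ^ 2) < 3 := by
      rw [Real.sqrt_lt' (by norm_num)]
      linarith
    linarith
  have hE : 0 ≤ erf b := by
    apply erf_nonneg
    rw [hb]
    have : 0 < 1 - a := sub_pos.mpr ha1
    positivity
  generalize erf b = E at *
  have hgap : 0 < c - E := by
    rw [hc, add_sub_cancel_right]
    positivity
  have hc0 : 0 < c := by linarith
  have hp0 : 0 < p := by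
    rw [hp]
    positivity
  have hp1 : p < 1 := by
    rw [hp, div_lt_one (by positivity)]
    linarith
  have hden : 0 < c - p * E := by nlinarith
  have hM_gap : (c - E) * (M * Real.sqrt Real.pi) =
      2 * σ * Real.sqrt r * Real.exp (-b ^ 2) := by
    rw [hc, add_sub_cancel_right]
    exact div_mul_cancel₀ _ (by positivity)
  have hq1 : 1 - qstar = c * (1 - p) / (c - p * E) := by
    rw [hqs]
    field_simp
    ring
  have hp1' : 0 < 1 - p := sub_pos.mpr hp1
  have hq0 : 0 < qstar := by
    rw [hqs]
    positivity
  rw [hq1, div_mul_eq_mul_div, div_eq_iff (by positivity), hqs]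
  calc
    _ = p * c * (1 - p) / (c - p * E) * (2 * σ * Real.sqrt r * Real.exp (-b ^ 2)) := by ring
    _ = _ := by
      rw [← hM_gap]
      ring
end

section
/- Suppose M, σ, r, l are positive real constants with rσ² ≥ M². Define V(q) = (M/r)·(1 − ((1−p)/p)^a·(q/(1−q))^a) for q ∈ [0,p) and V(q) = 0 for q ∈ [p,1]. Then the map f(q) = q·V(q) is strictly concave on [0,p], and there exists a unique q̂ ∈ [0,1] maximizing f over [0,1]; moreover q̂ ∈ (0,p). -/
open Set in
/-- For `a > 0`, the map `q ↦ q (q / (1 - q)) ^ a` is strictly convex on `[0, 1)`. -/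
theorem strictConvexOn_mul_odds_rpow {a : ℝ} (ha : 0 < a) :
    StrictConvexOn ℝ (Ico (0 : ℝ) 1) fun q ↦ q * (q / (1 - q)) ^ a := by
  refine StrictMonoOn.strictConvexOn_of_deriv (convex_Ico 0 1) ?_ ?_
  · refine continuousOn_id.mul (ContinuousOn.rpow_const ?_ fun _ _ ↦ Or.inr ha.le)
    exact continuousOn_id.div (by fun_prop) fun q hq ↦ (sub_pos.2 hq.2).ne'
  · rw [interior_Ico]
    have hderiv : ∀ q ∈ Ioo (0 : ℝ) 1, deriv (fun q : ℝ ↦ q * (q / (1 - q)) ^ a) q =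
        (q / (1 - q)) ^ a * (1 + a / (1 - q)) := by
      rintro q ⟨hq0, hq1⟩
      have h1 : 0 < 1 - q := sub_pos.2 hq1
      have hodds : 0 < q / (1 - q) := div_pos hq0 h1
      have hd := (hasDerivAt_id q).mul
        (((hasDerivAt_id q).div ((hasDerivAt_id q).const_sub 1) h1.ne').rpow_const
          (p := a) (Or.inl hodds.ne'))
      refine (HasDerivAt.congr_deriv hd ?_).deriv
      simp only [id, Pi.div_apply]
      rw [Real.rpow_sub_one hodds.ne']
      field_simp
      ring
    intro x hx y hy hxy
    rw [hderiv x hx, hderiv y hy]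
    have hx1 : 0 < 1 - x := sub_pos.2 hx.2
    have hy1 : 0 < 1 - y := sub_pos.2 hy.2
    have hodds : x / (1 - x) < y / (1 - y) := by
      rw [div_lt_div_iff₀ hx1 hy1]
      linarith
    have hpow := Real.rpow_lt_rpow (div_pos hx.1 hx1).le hodds ha
    have hfac : 1 + a / (1 - x) < 1 + a / (1 - y) := by gcongr
    exact mul_lt_mul'' hpow hfac (Real.rpow_nonneg (div_pos hx.1 hx1).le a) (by positivity)

open Set in
/-- A function that is continuous and strictly concave on `[0, p]`, vanishes at `0` and on `[p, 1]`,
has a unique maximizer over `[0, 1]`, which lies in `(0, p)`. -/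
theorem StrictConcaveOn.existsUnique_max_of_eq_zero {f : ℝ → ℝ} {p : ℝ} (hp0 : 0 < p)
    (hp1 : p ≤ 1) (hf : StrictConcaveOn ℝ (Icc 0 p) f) (hcont : ContinuousOn f (Icc 0 p))
    (hf0 : f 0 = 0) (hfp : ∀ q ∈ Icc p 1, f q = 0) :
    (∃! x : ℝ, x ∈ Icc (0 : ℝ) 1 ∧ ∀ q ∈ Icc (0 : ℝ) 1, f q ≤ f x) ∧
    (∀ x : ℝ, x ∈ Icc (0 : ℝ) 1 → (∀ q ∈ Icc (0 : ℝ) 1, f q ≤ f x) → x ∈ Ioo 0 p) := by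
  have hmid : 0 < f (p / 2) := by
    have h := hf.2 (left_mem_Icc.2 hp0.le) (right_mem_Icc.2 hp0.le) hp0.ne
      (half_pos one_pos) (half_pos one_pos) (add_halves 1)
    simp only [smul_eq_mul, hf0, hfp p ⟨le_rfl, hp1⟩, mul_zero, add_zero, zero_add] at h
    rwa [one_div_mul_eq_div] at h
  have hmem : ∀ x : ℝ, x ∈ Icc (0 : ℝ) 1 → (∀ q ∈ Icc (0 : ℝ) 1, f q ≤ f x) → x ∈ Ioo 0 p := by
    intro x hx hmax
    have hpos : 0 < f x := hmid.trans_le (hmax _ ⟨by linarith, by linarith⟩)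
    refine ⟨hx.1.lt_of_ne ?_, not_le.1 fun h ↦ hpos.ne' (hfp x ⟨h, hx.2⟩)⟩
    rintro rfl
    exact hpos.ne' hf0
  refine ⟨?_, hmem⟩
  obtain ⟨x, hx, hmax⟩ := isCompact_Icc.exists_isMaxOn (nonempty_Icc.2 hp0.le) hcont
  refine ⟨x, ⟨⟨hx.1, hx.2.trans hp1⟩, fun q hq ↦ ?_⟩, ?_⟩
  · rcases le_total q p with h | h
    · exact hmax ⟨hq.1, h⟩
    · rw [hfp q ⟨h, hq.2⟩, ← hf0]
      exact hmax (left_mem_Icc.2 hp0.le)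
  · rintro y ⟨hy, hymax⟩
    refine hf.eq_of_isMaxOn (fun q hq ↦ hymax q ⟨hq.1, hq.2.trans hp1⟩) hmax
      (Ioo_subset_Icc_self (hmem y hy hymax)) hx


/-- In the regime `rσ² ≥ M²`, with `p = (1+a)rl/((1+a)rl + aM)` and the attacker
value function `V` (equal to `(M/r)(1 − ((1−p)/p)^a(q/(1−q))^a)` on `[0,p)` and `0` on `[p,1]`),
the map `f(q) = q V(q)` is strictly concave on `[0,p]`, there is a unique maximizer of `f` over
`[0,1]`, and any such maximizer lies in `(0,p)`. -/
theorem stmt_14 (M σ r l : ℝ) (hM : 0 < M) (hσ : 0 < σ) (hr : 0 < r) (hl : 0 < l)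
    (hreg : M ^ 2 ≤ r * σ ^ 2) (a p : ℝ)
    (ha : a = (1 / 2) * (Real.sqrt (1 + 8 * r * σ ^ 2 / M ^ 2) - 1))
    (hp : p = (1 + a) * r * l / ((1 + a) * r * l + a * M))
    (V : ℝ → ℝ)
    (hV1 : ∀ q ∈ Set.Ico (0:ℝ) p,
      V q = (M / r) * (1 - ((1 - p) / p) ^ a * (q / (1 - q)) ^ a))
    (hV2 : ∀ q ∈ Set.Icc p 1, V q = 0)
    (f : ℝ → ℝ) (hf : ∀ q, f q = q * V q) :
    StrictConcaveOn ℝ (Set.Icc 0 p) f ∧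
    (∃! qhat : ℝ, qhat ∈ Set.Icc (0:ℝ) 1 ∧ ∀ q ∈ Set.Icc (0:ℝ) 1, f q ≤ f qhat) ∧
    (∀ qhat : ℝ, qhat ∈ Set.Icc (0:ℝ) 1 → (∀ q ∈ Set.Icc (0:ℝ) 1, f q ≤ f qhat) →
      qhat ∈ Set.Ioo 0 p) := by
  have ha0 : 0 < a := by
    have h : 1 < Real.sqrt (1 + 8 * r * σ ^ 2 / M ^ 2) := by
      rw [Real.lt_sqrt zero_le_one, one_pow, lt_add_iff_pos_right]
      positivity
    rw [ha]
    linarith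
  have hp0 : 0 < p := by
    rw [hp]
    positivity
  have hp1 : p < 1 := by
    rw [hp, div_lt_one (by positivity)]
    exact lt_add_of_pos_right _ (by positivity)
  have hq1 : 0 < 1 - p := sub_pos.2 hp1
  have hc : 0 < ((1 - p) / p) ^ a := Real.rpow_pos_of_pos (div_pos hq1 hp0) a
  have hf_eq : ∀ q ∈ Set.Icc 0 p,
      f q = (M / r) * (q - ((1 - p) / p) ^ a * (q * (q / (1 - q)) ^ a)) := by
    rintro q ⟨h0, h⟩
    rcases h.lt_or_eq with h | rfl
    · rw [hf, hV1 q ⟨h0, h⟩]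
      ring
    · have hinv : ((1 - q) / q) ^ a * (q / (1 - q)) ^ a = 1 := by
        rw [← Real.mul_rpow (by positivity) (by positivity), div_mul_div_cancel₀ hp0.ne',
          div_self hq1.ne', Real.one_rpow]
      rw [hf, hV2 q ⟨le_rfl, hp1.le⟩, mul_left_comm, hinv]
      ring
  have hconc : StrictConcaveOn ℝ (Set.Icc 0 p) f := by
    refine ⟨convex_Icc 0 p, fun x hx y hy hxy s t hs ht hst ↦ ?_⟩
    have h := (strictConvexOn_mul_odds_rpow ha0).2 ⟨hx.1, hx.2.trans_lt hp1⟩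
      ⟨hy.1, hy.2.trans_lt hp1⟩ hxy hs ht hst
    rw [hf_eq x hx, hf_eq y hy, hf_eq _ (convex_Icc 0 p hx hy hs.le ht.le hst)]
    simp only [smul_eq_mul] at h ⊢
    have h' := mul_lt_mul_of_pos_left (mul_lt_mul_of_pos_left h hc) (div_pos hM hr)
    linear_combination h'
  have hcont : ContinuousOn f (Set.Icc 0 p) := by
    refine ContinuousOn.congr ?_ hf_eq
    have hodds : ContinuousOn (fun q : ℝ ↦ (q / (1 - q)) ^ a) (Set.Icc 0 p) :=
      ContinuousOn.rpow_const
        (continuousOn_id.div (by fun_prop) fun q hq ↦ (sub_pos.2 (hq.2.trans_lt hp1)).ne')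
        fun _ _ ↦ Or.inr ha0.le
    fun_prop
  exact ⟨hconc, hconc.existsUnique_max_of_eq_zero hp0 hp1.le hcont (by rw [hf, zero_mul])
    fun q hq ↦ by rw [hf, hV2 q hq, mul_zero]⟩
end

section
/- Fix positive real constants σ, r, l. For M > 0, define a(M) = (1/2)·(√(1 + 8rσ²/M²) − 1) and p(M) = (1+a(M))rl/((1+a(M))rl + a(M)M). Then the map M ↦ p(M) is strictly decreasing on the interval (0, σ√r] (i.e., on the regime rσ² ≥ M²); in particular, ∂p/∂M = −8lr²σ²·(√(M²+8rσ²) − 2M)/(√(M²+8rσ²)·(−M² + lr√(M²+8rσ²) + M(lr + √(M²+8rσ²)))²) < 0 for 0 < M ≤ σ√r. -/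
theorem half_sqrt_one_add_div_sq_sub_one {c M : ℝ} (hM : 0 < M) :
    (1 / 2) * (Real.sqrt (1 + c / M ^ 2) - 1) = (Real.sqrt (M ^ 2 + c) - M) / (2 * M) := by
  have h : 1 + c / M ^ 2 = (M ^ 2 + c) / M ^ 2 := by field_simp
  rw [h, Real.sqrt_div' _ (sq_nonneg M), Real.sqrt_sq hM.le]
  field_simp

theorem lt_sqrt_sq_add {c M : ℝ} (hc : 0 < c) : M < Real.sqrt (M ^ 2 + c) :=
  Real.lt_sqrt_of_sq_lt (by linarith)

theorem threshold_denom_pos {c k M : ℝ} (hc : 0 < c) (hk : 0 < k) (hM : 0 < M) :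
    0 < (Real.sqrt (M ^ 2 + c) + M) * k + (Real.sqrt (M ^ 2 + c) - M) * M := by
  have h := sub_pos.2 (lt_sqrt_sq_add (M := M) hc)
  positivity

theorem hasDerivAt_threshold {c k M : ℝ} (hc : 0 < c) (hk : 0 < k) (hM : 0 < M) :
    HasDerivAt (fun x : ℝ => (Real.sqrt (x ^ 2 + c) + x) * k /
        ((Real.sqrt (x ^ 2 + c) + x) * k + (Real.sqrt (x ^ 2 + c) - x) * x))
      (-(c * k * (Real.sqrt (M ^ 2 + c) - 2 * M)) / (Real.sqrt (M ^ 2 + c) *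
        ((Real.sqrt (M ^ 2 + c) + M) * k + (Real.sqrt (M ^ 2 + c) - M) * M) ^ 2)) M := by
  have hpos : 0 < M ^ 2 + c := by positivity
  have hS : HasDerivAt (fun x : ℝ => Real.sqrt (x ^ 2 + c)) (M / Real.sqrt (M ^ 2 + c)) M := by
    refine (((hasDerivAt_pow 2 M).add_const c).sqrt hpos.ne').congr_deriv ?_
    simp [mul_div_mul_left]
  have hD := threshold_denom_pos hc hk hM
  have hN := (hS.add (hasDerivAt_id M)).mul_const k
  have hK := (hS.sub (hasDerivAt_id M)).mul (hasDerivAt_id M)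
  have hS0 := Real.sqrt_pos.2 hpos
  have hsq := Real.sq_sqrt hpos.le
  refine (hN.div (hN.add hK) hD.ne').congr_deriv ?_
  simp only [Pi.add_apply, Pi.sub_apply, Pi.mul_apply, id]
  generalize Real.sqrt (M ^ 2 + c) = S at *
  obtain rfl : c = S ^ 2 - M ^ 2 := by linarith
  have hD0 := hD.ne'
  rw [← mul_div_mul_left _ (((S + M) * k + (S - M) * M) ^ 2) hS0.ne']
  congr 1
  field_simp
  ring

theorem two_mul_lt_sqrt_sq_add {σ r M : ℝ} (hr : 0 < r) (hM : 0 < M)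
    (h : M ≤ σ * Real.sqrt r) : 2 * M < Real.sqrt (M ^ 2 + 8 * r * σ ^ 2) := by
  have h2 : M ^ 2 ≤ (σ * Real.sqrt r) ^ 2 := pow_le_pow_left₀ hM.le h 2
  rw [mul_pow, Real.sq_sqrt hr.le] at h2
  apply Real.lt_sqrt_of_sq_lt
  nlinarith [pow_pos hM 2]


/-- Fixing `σ, r, l > 0`, the map `M ↦ p(M) = (1+a(M))rl/((1+a(M))rl + a(M)M)`
is strictly decreasing on `(0, σ√r]` (the regime `rσ² ≥ M²`); in particular, for
`0 < M ≤ σ√r`,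
`∂p/∂M = −8lr²σ²(√(M²+8rσ²) − 2M)/(√(M²+8rσ²)(−M² + lr√(M²+8rσ²) + M(lr + √(M²+8rσ²)))²) < 0`. -/
theorem stmt_19 (σ r l : ℝ) (hσ : 0 < σ) (hr : 0 < r) (hl : 0 < l)
    (a p : ℝ → ℝ)
    (ha : ∀ M, a M = (1 / 2) * (Real.sqrt (1 + 8 * r * σ ^ 2 / M ^ 2) - 1))
    (hp : ∀ M, p M = (1 + a M) * r * l / ((1 + a M) * r * l + a M * M)) :
    StrictAntiOn p (Set.Ioc 0 (σ * Real.sqrt r)) ∧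
    (∀ M : ℝ, 0 < M → M ≤ σ * Real.sqrt r →
      HasDerivAt p
        (-(8 * l * r ^ 2 * σ ^ 2 * (Real.sqrt (M ^ 2 + 8 * r * σ ^ 2) - 2 * M))
          / (Real.sqrt (M ^ 2 + 8 * r * σ ^ 2)
            * (-M ^ 2 + l * r * Real.sqrt (M ^ 2 + 8 * r * σ ^ 2)
              + M * (l * r + Real.sqrt (M ^ 2 + 8 * r * σ ^ 2))) ^ 2)) M ∧
      -(8 * l * r ^ 2 * σ ^ 2 * (Real.sqrt (M ^ 2 + 8 * r * σ ^ 2) - 2 * M))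
          / (Real.sqrt (M ^ 2 + 8 * r * σ ^ 2)
            * (-M ^ 2 + l * r * Real.sqrt (M ^ 2 + 8 * r * σ ^ 2)
              + M * (l * r + Real.sqrt (M ^ 2 + 8 * r * σ ^ 2))) ^ 2) < 0) := by
  have hc : 0 < 8 * r * σ ^ 2 := by positivity
  have hk : 0 < r * l := by positivity
  have main : ∀ M : ℝ, 0 < M → M ≤ σ * Real.sqrt r →
      HasDerivAt p
        (-(8 * l * r ^ 2 * σ ^ 2 * (Real.sqrt (M ^ 2 + 8 * r * σ ^ 2) - 2 * M))
          / (Real.sqrt (M ^ 2 + 8 * r * σ ^ 2)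
            * (-M ^ 2 + l * r * Real.sqrt (M ^ 2 + 8 * r * σ ^ 2)
              + M * (l * r + Real.sqrt (M ^ 2 + 8 * r * σ ^ 2))) ^ 2)) M ∧
      -(8 * l * r ^ 2 * σ ^ 2 * (Real.sqrt (M ^ 2 + 8 * r * σ ^ 2) - 2 * M))
          / (Real.sqrt (M ^ 2 + 8 * r * σ ^ 2)
            * (-M ^ 2 + l * r * Real.sqrt (M ^ 2 + 8 * r * σ ^ 2)
              + M * (l * r + Real.sqrt (M ^ 2 + 8 * r * σ ^ 2))) ^ 2) < 0 := by
    intro M hM hMle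
    constructor
    · have hderiv := hasDerivAt_threshold hc hk hM
      have heq : p =ᶠ[nhds M] fun x : ℝ => (Real.sqrt (x ^ 2 + 8 * r * σ ^ 2) + x) * (r * l) /
          ((Real.sqrt (x ^ 2 + 8 * r * σ ^ 2) + x) * (r * l) +
            (Real.sqrt (x ^ 2 + 8 * r * σ ^ 2) - x) * x) := by
        filter_upwards [lt_mem_nhds hM] with x hx
        rw [hp, ha, half_sqrt_one_add_div_sq_sub_one hx,
          ← mul_div_mul_left _ _ (mul_pos two_pos hx).ne']
        congr 1 <;> field_simp <;> ring
      refine (hderiv.congr_of_eventuallyEq heq).congr_deriv ?_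
      congr 1 <;> ring
    · have hS := sub_pos.2 (two_mul_lt_sqrt_sq_add hr hM hMle)
      have hS0 : 0 < Real.sqrt (M ^ 2 + 8 * r * σ ^ 2) := Real.sqrt_pos.2 (by positivity)
      have hD := threshold_denom_pos hc hk hM
      refine div_neg_of_neg_of_pos (neg_neg_of_pos (by positivity))
        (mul_pos hS0 (pow_pos ?_ 2))
      linarith
  refine ⟨strictAntiOn_of_deriv_neg (convex_Ioc _ _)
    (fun x hx => (main x hx.1 hx.2).1.continuousAt.continuousWithinAt) (fun x hx => ?_), main⟩
  have hx' := interior_subset hx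
  rw [(main x hx'.1 hx'.2).1.deriv]
  exact (main x hx'.1 hx'.2).2
end
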